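/- arXiv:2204.13218 — 2 statements merged into one kernel-verified Lean document; each statement's English description precedes it below -/
import Mathlib

section
/- Let X : ℝ → (E →L[ℝ] E) be a differentiable family of self-adjoint operators satisfying the Riccati equation X'(t) + X(t) ∘ X(t) + R(t) = 0 for all t ∈ ℝ. Then L := {J : ℝ → E : J is differentiable and J'(t) = X(t)(J(t)) for all t ∈ ℝ} is an n-dimensional subspace of the space 𝒥 of Jacobi fields on which ω vanishes identically; that is, L is a Lagrangian subspace of 𝒥. -/
open scoped RealInnerProductSpace

noncomputable section

/-- Euclidean space `ℝ^n`. -/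
abbrev Euc (n : ℕ) := EuclideanSpace ℝ (Fin n)

/-- `J : ℝ → ℝ^n` is a Jacobi field for the curvature family `R`:
it is twice differentiable and satisfies `J'' + R J = 0`. -/
def IsJacobi {n : ℕ} (R : ℝ → (Euc n →L[ℝ] Euc n)) (J : ℝ → Euc n) : Prop :=
  Differentiable ℝ J ∧ Differentiable ℝ (deriv J) ∧
    ∀ t : ℝ, deriv (deriv J) t + R t (J t) = 0

/-- The (candidate) symplectic pairing of two fields, evaluated at time `t`. -/
def om {n : ℕ} (J₁ J₂ : ℝ → Euc n) (t : ℝ) : ℝ :=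
  ⟪deriv J₁ t, J₂ t⟫ - ⟪J₁ t, deriv J₂ t⟫

section LinearODE

variable {E : Type*} [NormedAddCommGroup E] [NormedSpace ℝ E]

/-- The terms of the Picard (Dyson) series solving `J' = A J`, `J 0 = x`. -/
def picardTerm (A : ℝ → E →L[ℝ] E) (x : E) : ℕ → ℝ → E
  | 0 => fun _ => x
  | k + 1 => fun t => ∫ s in (0 : ℝ)..t, A s (picardTerm A x k s)

/-- A continuous family of operators is bounded on bounded intervals. -/
theorem exists_norm_le_on_interval {A : ℝ → E →L[ℝ] E} (hA : Continuous A) (T : ℝ) :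
    ∃ K : NNReal, ∀ t ∈ Set.Icc (-T) T, ‖A t‖ ≤ K := by
  obtain ⟨C, hC⟩ := isCompact_Icc.exists_bound_of_continuousOn
    (hA.continuousOn (s := Set.Icc (-T) T))
  exact ⟨C.toNNReal, fun t ht => (hC t ht).trans (Real.le_coe_toNNReal C)⟩

theorem linearODE_unique {A : ℝ → E →L[ℝ] E} (hA : Continuous A) {f g : ℝ → E}
    (hf : ∀ t, HasDerivAt f (A t (f t)) t) (hg : ∀ t, HasDerivAt g (A t (g t)) t)
    (h0 : f 0 = g 0) : f = g := by
  funext t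
  obtain ⟨K, hK⟩ := exists_norm_le_on_interval hA (|t| + 1)
  have ht := abs_nonneg t
  refine ODE_solution_unique_of_mem_Ioo (v := fun t x => A t x) (s := fun _ => Set.univ)
    (K := K) (a := -(|t| + 1)) (b := |t| + 1) (t₀ := 0) ?_ ⟨by linarith, by linarith⟩
    (fun s _ => ⟨hf s, trivial⟩) (fun s _ => ⟨hg s, trivial⟩) h0
    ⟨by linarith [neg_abs_le t], by linarith [le_abs_self t]⟩
  intro s hs
  exact ((A s).lipschitz.weaken (hK s (Set.Ioo_subset_Icc_self hs))).lipschitzOnWith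

theorem picardTerm_continuous {A : ℝ → E →L[ℝ] E} (hA : Continuous A) (x : E) (k : ℕ) :
    Continuous (picardTerm A x k) := by
  induction k with
  | zero => exact continuous_const
  | succ k ih =>
    exact intervalIntegral.continuous_primitive
      (fun a b => (hA.clm_apply ih).intervalIntegrable a b) 0

theorem norm_picardTerm_le {A : ℝ → E →L[ℝ] E} {T : ℝ} {K : NNReal}
    (hK : ∀ t ∈ Set.Icc (-T) T, ‖A t‖ ≤ K) (x : E) (k : ℕ) :
    ∀ t ∈ Set.Icc (-T) T, ‖picardTerm A x k t‖ ≤ (K * |t|) ^ k / k.factorial * ‖x‖ := by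
  induction k with
  | zero => simp [picardTerm]
  | succ k ih =>
    intro t ht
    have hT : 0 ≤ T := by linarith [ht.1, ht.2]
    calc ‖picardTerm A x (k + 1) t‖
        ≤ ∫ s in Set.uIoc 0 t, (K : ℝ) ^ (k + 1) / k.factorial * ‖x‖ * |s - 0| ^ k := by
          rw [picardTerm, intervalIntegral.norm_intervalIntegral_eq]
          apply MeasureTheory.norm_integral_le_of_norm_le
            (Continuous.integrableOn_uIoc (by fun_prop))
          refine (MeasureTheory.ae_restrict_mem measurableSet_uIoc).mono fun s hs => ?_
          have hs' : s ∈ Set.Icc (-T) T :=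
            (Set.uIoc_subset_uIcc.trans (Set.uIcc_subset_Icc ⟨by linarith, hT⟩ ht)) hs
          calc ‖A s (picardTerm A x k s)‖
              ≤ K * ((K * |s|) ^ k / k.factorial * ‖x‖) :=
                (A s).le_of_opNorm_le_of_le (hK s hs') (ih s hs')
            _ = _ := by rw [sub_zero]; ring
      _ = (K * |t|) ^ (k + 1) / (k + 1).factorial * ‖x‖ := by
          rw [MeasureTheory.integral_const_mul, integral_pow_abs_sub_uIoc, sub_zero,
            Nat.factorial_succ]
          push_cast
          field_simp
          ring

variable [CompleteSpace E]

theorem picardTerm_succ_hasDerivAt {A : ℝ → E →L[ℝ] E} (hA : Continuous A) (x : E) (k : ℕ)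
    (t : ℝ) : HasDerivAt (picardTerm A x (k + 1)) (A t (picardTerm A x k t)) t :=
  (hA.clm_apply (picardTerm_continuous hA x k)).integral_hasStrictDerivAt 0 t |>.hasDerivAt

/-- Global existence for a homogeneous linear ODE with continuous coefficients. -/
theorem linearODE_exists {A : ℝ → E →L[ℝ] E} (hA : Continuous A) (x : E) :
    ∃ f : ℝ → E, f 0 = x ∧ ∀ t, HasDerivAt f (A t (f t)) t := by
  have hsum : ∀ t, Summable fun k => picardTerm A x k t := fun t => by
    obtain ⟨K, hK⟩ := exists_norm_le_on_interval hA |t|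
    exact .of_norm_bounded ((Real.summable_pow_div_factorial (K * |t|)).mul_right ‖x‖)
      fun k => norm_picardTerm_le hK x k t ⟨neg_abs_le t, le_abs_self t⟩
  refine ⟨fun t => x + ∑' k, picardTerm A x (k + 1) t, by simp [picardTerm], fun t => ?_⟩
  obtain ⟨K, hK⟩ := exists_norm_le_on_interval hA (|t| + 1)
  have ht := abs_nonneg t
  have key : HasDerivAt (fun z => ∑' k, picardTerm A x (k + 1) z)
      (∑' k, A t (picardTerm A x k t)) t := by
    refine hasDerivAt_tsum_of_isPreconnected (t := Set.Ioo (-(|t| + 1)) (|t| + 1)) (y₀ := t)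
      (u := fun k => K * ((K * (|t| + 1)) ^ k / k.factorial * ‖x‖))
      (((Real.summable_pow_div_factorial _).mul_right ‖x‖).mul_left _) isOpen_Ioo
      isPreconnected_Ioo (g' := fun k s => A s (picardTerm A x k s))
      (fun k s _ => picardTerm_succ_hasDerivAt hA x k s) (fun k s hs => ?_) ?_
      ((summable_nat_add_iff 1).2 (hsum t)) ?_
    · have hs' := Set.Ioo_subset_Icc_self hs
      refine (A s).le_of_opNorm_le_of_le (hK s hs') ((norm_picardTerm_le hK x k s hs').trans ?_)
      have : |s| ≤ |t| + 1 := abs_le.2 hs'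
      gcongr
    all_goals exact ⟨by linarith [neg_abs_le t], by linarith [le_abs_self t]⟩
  rw [← (A t).map_tsum (hsum t), (hsum t).tsum_eq_zero_add] at key
  exact key.const_add x

end LinearODE

/-- The space of solutions of the linear ODE `J' = A J`. -/
def linearODESolutions {E : Type*} [NormedAddCommGroup E] [NormedSpace ℝ E]
    (A : ℝ → E →L[ℝ] E) : Submodule ℝ (ℝ → E) where
  carrier := {J | Differentiable ℝ J ∧ ∀ t : ℝ, deriv J t = A t (J t)}
  add_mem' := fun {f g} hf hg => ⟨hf.1.add hg.1, fun t => by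
    rw [deriv_add (hf.1 t) (hg.1 t), hf.2, hg.2, Pi.add_apply, map_add]⟩
  zero_mem' := ⟨differentiable_const 0, fun t => by simp⟩
  smul_mem' := fun c f hf => ⟨hf.1.const_smul c, fun t => by
    rw [deriv_const_smul c (hf.1 t), hf.2, Pi.smul_apply, map_smul]⟩

/-- Evaluation at time `0` identifies the solution space with the space of initial values. -/
theorem finrank_linearODESolutions {E : Type*} [NormedAddCommGroup E] [NormedSpace ℝ E]
    [CompleteSpace E] {A : ℝ → E →L[ℝ] E} (hA : Continuous A) :
    Module.finrank ℝ (linearODESolutions A) = Module.finrank ℝ E := by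
  have hderiv : ∀ f ∈ linearODESolutions A, ∀ t, HasDerivAt f (A t (f t)) t :=
    fun f hf t => hf.2 t ▸ (hf.1 t).hasDerivAt
  refine (LinearEquiv.ofBijective
    ((LinearMap.proj (R := ℝ) (φ := fun _ : ℝ => E) 0).comp (linearODESolutions A).subtype)
    ⟨fun f g h => Subtype.ext ?_, fun x => ?_⟩).finrank_eq
  · exact linearODE_unique hA (hderiv f f.2) (hderiv g g.2) h
  · obtain ⟨f, hf0, hf⟩ := linearODE_exists hA x
    exact ⟨⟨f, fun t => (hf t).differentiableAt, fun t => (hf t).deriv⟩, hf0⟩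

/-- A solution of `J' = X J`, with `X` a Riccati solution, is a Jacobi field. -/
theorem isJacobi_of_riccati {n : ℕ} {R X : ℝ → (Euc n →L[ℝ] Euc n)}
    (hXdiff : Differentiable ℝ X) (hricc : ∀ t : ℝ, deriv X t + (X t).comp (X t) + R t = 0)
    {J : ℝ → Euc n} (hJ : Differentiable ℝ J) (hJX : ∀ t : ℝ, deriv J t = X t (J t)) :
    IsJacobi R J := by
  have hJ' : deriv J = fun t => X t (J t) := funext hJX
  have hd : ∀ t, HasDerivAt (deriv J) (deriv X t (J t) + X t (X t (J t))) t := fun t => by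
    rw [hJ', ← hJX t]
    exact (hXdiff t).hasDerivAt.clm_apply (hJ t).hasDerivAt
  refine ⟨hJ, fun t => (hd t).differentiableAt, fun t => ?_⟩
  rw [(hd t).deriv]
  exact DFunLike.congr_fun (hricc t) (J t)

theorem stmt_9 {n : ℕ} (hn : 1 ≤ n) (R : ℝ → (Euc n →L[ℝ] Euc n))
    (hRcont : Continuous R)
    (hRsym : ∀ t : ℝ, ∀ v w : Euc n, ⟪R t v, w⟫ = ⟪v, R t w⟫)
    (X : ℝ → (Euc n →L[ℝ] Euc n))
    (hXdiff : Differentiable ℝ X)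
    (hXsym : ∀ t : ℝ, ∀ v w : Euc n, ⟪X t v, w⟫ = ⟪v, X t w⟫)
    (hricc : ∀ t : ℝ, deriv X t + (X t).comp (X t) + R t = 0) :
    {J : ℝ → Euc n | Differentiable ℝ J ∧ ∀ t : ℝ, deriv J t = X t (J t)}
      ⊆ {J : ℝ → Euc n | IsJacobi R J} ∧
    (∀ J₁ ∈ {J : ℝ → Euc n | Differentiable ℝ J ∧ ∀ t : ℝ, deriv J t = X t (J t)},
      ∀ J₂ ∈ {J : ℝ → Euc n | Differentiable ℝ J ∧ ∀ t : ℝ, deriv J t = X t (J t)},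
        om J₁ J₂ 0 = 0) ∧
    Module.finrank ℝ (Submodule.span ℝ
      {J : ℝ → Euc n | Differentiable ℝ J ∧ ∀ t : ℝ, deriv J t = X t (J t)}) = n := by
  refine ⟨fun J hJ => isJacobi_of_riccati hXdiff hricc hJ.1 hJ.2, fun J₁ h₁ J₂ h₂ => ?_, ?_⟩
  · rw [om, h₁.2, h₂.2, hXsym, sub_self]
  · change Module.finrank ℝ (Submodule.span ℝ (linearODESolutions X : Set (ℝ → Euc n))) = n
    rw [Submodule.span_eq, finrank_linearODESolutions hXdiff.continuous,
      finrank_euclideanSpace_fin]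
end
end

section
/- Let L ⊆ 𝒥 be a Lagrangian subspace, let ℐ := span{J ∈ L : J(t) = 0 for some t ∈ ℝ}, and for each t ∈ ℝ let V_t := {J(t) : J ∈ ℐ} + {J'(t) : J ∈ ℐ, J(t) = 0}. Then for every t ∈ ℝ one has {J(t) : J ∈ L} + V_t = E; that is, every instant is regular for the ℐ-transverse Lagrangian subspace induced by L. -/
open scoped RealInnerProductSpace

noncomputable section

/-- The span of the Jacobi fields in `L` vanishing somewhere. -/
def spanZero {n : ℕ} (L : Submodule ℝ (ℝ → Euc n)) : Submodule ℝ (ℝ → Euc n) :=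
  Submodule.span ℝ {J : ℝ → Euc n | J ∈ L ∧ ∃ t : ℝ, J t = 0}

/-- The fiber at time `t` of the vertical bundle associated with a space `I` of
Jacobi fields: `I(t) + D(I_t⁰)(t)`. -/
def vertFib {n : ℕ} (I : Submodule ℝ (ℝ → Euc n)) (t : ℝ) : Set (Euc n) :=
  {v | ∃ J ∈ I, ∃ J' ∈ I, J' t = 0 ∧ v = J t + deriv J' t}

/-- The symplectic pairing of two Jacobi fields does not depend on time. -/
theorem IsJacobi.om_eq {n : ℕ} {R : ℝ → (Euc n →L[ℝ] Euc n)}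
    (hRsym : ∀ t : ℝ, ∀ v w : Euc n, ⟪R t v, w⟫ = ⟪v, R t w⟫)
    {J₁ J₂ : ℝ → Euc n} (h₁ : IsJacobi R J₁) (h₂ : IsJacobi R J₂) (s t : ℝ) :
    om J₁ J₂ s = om J₁ J₂ t := by
  have hder : ∀ t, HasDerivAt (om J₁ J₂) 0 t := by
    intro t
    have e₁ := eq_neg_of_add_eq_zero_left (h₁.2.2 t)
    have e₂ := eq_neg_of_add_eq_zero_left (h₂.2.2 t)
    have h := ((h₁.2.1 t).hasDerivAt.inner ℝ (h₂.1 t).hasDerivAt).sub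
      ((h₁.1 t).hasDerivAt.inner ℝ (h₂.2.1 t).hasDerivAt)
    refine h.congr_deriv ?_
    rw [e₁, e₂, inner_neg_left, inner_neg_right, hRsym]
    ring
  exact is_const_of_deriv_eq_zero (fun t => (hder t).differentiableAt)
    (fun t => (hder t).deriv) s t

/-- A Jacobi field with vanishing initial data is identically zero. -/
theorem IsJacobi.eq_zero {n : ℕ} {R : ℝ → (Euc n →L[ℝ] Euc n)} (hRcont : Continuous R)
    {J : ℝ → Euc n} (hJ : IsJacobi R J) {t : ℝ} (h0 : J t = 0) (h1 : deriv J t = 0) :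
    J = 0 := by
  funext s
  obtain ⟨C, hC⟩ := (isCompact_Icc (a := min s t - 1)
    (b := max s t + 1)).exists_bound_of_continuousOn hRcont.continuousOn
  have hmem : ∀ r, min s t ≤ r → r ≤ max s t → r ∈ Set.Ioo (min s t - 1) (max s t + 1) :=
    fun r h h' => ⟨by linarith, by linarith⟩
  let v : ℝ → Euc n × Euc n → Euc n × Euc n := fun r p => (p.2, -R r p.1)
  have hv : ∀ r ∈ Set.Ioo (min s t - 1) (max s t + 1),
      LipschitzOnWith (max 1 C.toNNReal) (v r) Set.univ := by
    intro r hr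
    refine LipschitzWith.lipschitzOnWith (LipschitzWith.prodMk ?_ ?_)
    · exact LipschitzWith.prod_snd
    · have hR : LipschitzWith C.toNNReal (R r) :=
        (R r).lipschitz.weaken (by
          rw [← NNReal.coe_le_coe, coe_nnnorm]
          exact (hC r (Set.Ioo_subset_Icc_self hr)).trans (Real.le_coe_toNNReal C))
      have h := (hR.comp (LipschitzWith.prod_fst (α := Euc n) (β := Euc n))).neg
      rw [mul_one] at h
      exact h
  have key := ODE_solution_unique_of_mem_Ioo (v := v) (s := fun _ => Set.univ)
    (f := fun r => (J r, deriv J r)) (g := fun _ => 0) hv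
    (hmem t (min_le_right _ _) (le_max_right _ _))
    (fun r _ => ⟨by
      refine ((hJ.1 r).hasDerivAt.prodMk (hJ.2.1 r).hasDerivAt).congr_deriv ?_
      simp only [v, eq_neg_of_add_eq_zero_left (hJ.2.2 r)], trivial⟩)
    (fun r _ => ⟨(hasDerivAt_const r (0 : Euc n × Euc n)).congr_deriv (by simp [v, Prod.zero_eq_mk]), trivial⟩)
    (by simp [h0, h1])
  exact congrArg Prod.fst (key (hmem s (min_le_left _ _) (le_max_left _ _)))

theorem stmt_15 {n : ℕ} (hn : 1 ≤ n) (R : ℝ → (Euc n →L[ℝ] Euc n))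
    (hRcont : Continuous R)
    (hRsym : ∀ t : ℝ, ∀ v w : Euc n, ⟪R t v, w⟫ = ⟪v, R t w⟫)
    (L : Submodule ℝ (ℝ → Euc n))
    (hLJ : ∀ J ∈ L, IsJacobi R J)
    (hiso : ∀ J₁ ∈ L, ∀ J₂ ∈ L, om J₁ J₂ 0 = 0)
    (hdim : Module.finrank ℝ L = n) :
    ∀ t : ℝ, ∀ v : Euc n, ∃ J ∈ L, ∃ w ∈ vertFib (spanZero L) t, v = J t + w := by
  intro t v
  have : FiniteDimensional ℝ L := Module.finite_of_finrank_pos (by omega)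
  let ev : L →ₗ[ℝ] Euc n := (LinearMap.proj t).comp L.subtype
  let D : L →ₗ[ℝ] Euc n :=
    { toFun := fun J => deriv J.1 t
      map_add' := fun J K => deriv_add ((hLJ _ J.2).1 t) ((hLJ _ K.2).1 t)
      map_smul' := fun c J => deriv_const_smul c ((hLJ _ J.2).1 t) }
  let D₀ : LinearMap.ker ev →ₗ[ℝ] Euc n := D.comp (LinearMap.ker ev).subtype
  have hinj : Function.Injective D₀ := by
    intro J K hJK
    have hJ : J.1.1 t = 0 := J.2
    have hK : K.1.1 t = 0 := K.2
    have hd : deriv (J.1.1 - K.1.1) t = 0 :=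
      (deriv_sub ((hLJ _ J.1.2).1 t) ((hLJ _ K.1.2).1 t)).trans (sub_eq_zero.2 hJK)
    have h : J.1.1 - K.1.1 = 0 := (hLJ _ (L.sub_mem J.1.2 K.1.2)).eq_zero hRcont (t := t)
      (by rw [Pi.sub_apply, hJ, hK, sub_zero]) hd
    exact Subtype.ext (Subtype.ext (sub_eq_zero.1 h))
  have horth : LinearMap.range ev ⟂ LinearMap.range D₀ := by
    rw [Submodule.isOrtho_iff_inner_eq]
    rintro _ ⟨K, rfl⟩ _ ⟨J, rfl⟩
    have h : om J.1.1 K.1 t = 0 :=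
      ((hLJ _ J.1.2).om_eq hRsym (hLJ _ K.2) t 0).trans (hiso _ J.1.2 _ K.2)
    have hJ : J.1.1 t = 0 := J.2
    rw [om, hJ, inner_zero_left, sub_zero, real_inner_comm] at h
    exact h
  have htop : LinearMap.range ev ⊔ LinearMap.range D₀ = ⊤ := by
    refine Submodule.eq_top_of_disjoint _ _ ?_ horth.disjoint
    rw [LinearMap.finrank_range_of_inj hinj, LinearMap.finrank_range_add_finrank_ker, hdim,
      finrank_euclideanSpace_fin]
  obtain ⟨_, ⟨J, rfl⟩, _, ⟨K, rfl⟩, hv⟩ :=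
    Submodule.mem_sup.1 (htop ▸ Submodule.mem_top : v ∈ LinearMap.range ev ⊔ LinearMap.range D₀)
  exact ⟨J.1, J.2, _, ⟨0, Submodule.zero_mem _, K.1.1,
    Submodule.subset_span ⟨K.1.2, t, K.2⟩, K.2, (zero_add _).symm⟩, hv.symm⟩
end
end
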